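/- Fix real v̄, σ, ρ, v₀, r with σ ≠ 0, t > 0, S₀ > 0, and u ∈ ℂ with u ≠ 0. For κ ∈ ℝ define ξ(κ) := κ − σρiu, d(κ) := (ξ(κ)² + σ²(u²+iu))^{1/2} (principal square root), A₁, A₂, A := A₁/A₂, B := d·e^{κt/2}/A₂, X := (d+ξ)/2 + ((d−ξ)/2)e^{−dt}, D := Log d + (κ−d)t/2 − Log X, and φ(κ) := exp( iu(log S₀ + rt) − tκv̄ρiu/σ − v₀·A + (2κv̄/σ²)·D ). Suppose at κ₀: ξ(κ₀)² + σ²(u²+iu) ∉ (−∞, 0], d(κ₀) ∉ (−∞, 0], X(κ₀) ∉ (−∞, 0], and A₂(κ₀) ≠ 0. Then κ ↦ φ(κ) is differentiable at κ₀ with derivative φ(κ₀)·h₄, where h₄ := (v₀/(σiu))·Aρ' + (2v̄/σ²)·D + (2κ₀v̄/(σ²B))·Bκ' − tv̄ρiu/σ, with Aρ' the explicit ρ-partial derivative of A (Aρ' := (1/A₂)A₁ρ' − (A/A₂)A₂ρ', A₁ρ' := −iu(u²+iu)tξσ cosh(dt/2)/(2d), A₂ρ' := −σiu(2+tξ)(ξ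 cosh(dt/2)+d sinh(dt/2))/(2d)) and Bκ' := (i/(σu))·e^{κ₀t/2}((1/A₂)(−ξσiu/d) − (d/A₂²)A₂ρ') + tB/2, all evaluated at κ₀. -/

import Mathlib

noncomputable section

/-- Principal complex square root `z^{1/2} := exp((1/2)·Log z)`. -/
def csqrt (z : ℂ) : ℂ := Complex.exp ((1 / 2 : ℂ) * Complex.log z)

/-- `ξ(κ) := κ − σρiu`. -/
def ξf (σ ρ : ℝ) (u : ℂ) (κ : ℝ) : ℂ := (κ : ℂ) - (σ : ℂ) * (ρ : ℂ) * Complex.I * u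

/-- `d(κ) := (ξ(κ)² + σ²(u²+iu))^{1/2}` (principal square root). -/
def df (σ ρ : ℝ) (u : ℂ) (κ : ℝ) : ℂ :=
  csqrt ((ξf σ ρ u κ) ^ 2 + (σ : ℂ) ^ 2 * (u ^ 2 + Complex.I * u))

/-- `A₁(κ) := (u²+iu)·sinh(d(κ)t/2)`. -/
def A₁f (σ ρ t : ℝ) (u : ℂ) (κ : ℝ) : ℂ :=
  (u ^ 2 + Complex.I * u) * Complex.sinh (df σ ρ u κ * (t : ℂ) / 2)

/-- `A₂(κ) := d(κ)·cosh(d(κ)t/2) + ξ(κ)·sinh(d(κ)t/2)`. -/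
def A₂f (σ ρ t : ℝ) (u : ℂ) (κ : ℝ) : ℂ :=
  df σ ρ u κ * Complex.cosh (df σ ρ u κ * (t : ℂ) / 2) +
    ξf σ ρ u κ * Complex.sinh (df σ ρ u κ * (t : ℂ) / 2)

/-- `A(κ) := A₁(κ)/A₂(κ)`. -/
def Af (σ ρ t : ℝ) (u : ℂ) (κ : ℝ) : ℂ := A₁f σ ρ t u κ / A₂f σ ρ t u κ

/-- `B(κ) := d(κ)·e^{κt/2}/A₂(κ)`. -/
def Bf (σ ρ t : ℝ) (u : ℂ) (κ : ℝ) : ℂ :=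
  df σ ρ u κ * Complex.exp ((κ : ℂ) * (t : ℂ) / 2) / A₂f σ ρ t u κ

/-- `X(κ) := (d+ξ)/2 + ((d−ξ)/2)·e^{−dt}`. -/
def Xf (σ ρ t : ℝ) (u : ℂ) (κ : ℝ) : ℂ :=
  (df σ ρ u κ + ξf σ ρ u κ) / 2 +
    (df σ ρ u κ - ξf σ ρ u κ) / 2 * Complex.exp (-(df σ ρ u κ * (t : ℂ)))

/-- `D(κ) := Log d + (κ−d)t/2 − Log X`. -/
def Dfn (σ ρ t : ℝ) (u : ℂ) (κ : ℝ) : ℂ :=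
  Complex.log (df σ ρ u κ) + ((κ : ℂ) - df σ ρ u κ) * (t : ℂ) / 2 -
    Complex.log (Xf σ ρ t u κ)

/-- The Cui representation `φ(κ)` of the Heston characteristic function as a function of `κ`. -/
def φf (vb σ ρ v₀ r t S₀ : ℝ) (u : ℂ) (κ : ℝ) : ℂ :=
  Complex.exp (Complex.I * u * ((Real.log S₀ : ℂ) + (r : ℂ) * (t : ℂ))
    - (t : ℂ) * (κ : ℂ) * (vb : ℂ) * (ρ : ℂ) * Complex.I * u / (σ : ℂ)
    - (v₀ : ℂ) * Af σ ρ t u κ + (2 * (κ : ℂ) * (vb : ℂ) / (σ : ℂ) ^ 2) * Dfn σ ρ t u κ)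

theorem csqrt_ne_zero (z : ℂ) : csqrt z ≠ 0 := Complex.exp_ne_zero _

theorem csqrt_sq {z : ℂ} (hz : z ≠ 0) : csqrt z ^ 2 = z := by
  rw [csqrt, ← Complex.exp_nat_mul]
  convert Complex.exp_log hz using 2
  push_cast
  ring

theorem hasDerivAt_csqrt {z : ℂ} (hz : z ∈ Complex.slitPlane) :
    HasDerivAt csqrt (1 / (2 * csqrt z)) z := by
  have h := ((Complex.hasDerivAt_log hz).const_mul (1 / 2 : ℂ)).cexp
  refine h.congr_deriv ?_
  change csqrt z * _ = _
  have hz0 := Complex.slitPlane_ne_zero hz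
  have hs := csqrt_ne_zero z
  field_simp
  exact csqrt_sq hz0

theorem hasDerivAt_ξf (σ ρ : ℝ) (u : ℂ) (κ : ℝ) : HasDerivAt (ξf σ ρ u) 1 κ :=
  Complex.ofRealCLM.hasDerivAt.sub_const _

theorem hasDerivAt_df {σ ρ : ℝ} {u : ℂ} {κ : ℝ}
    (hw : (ξf σ ρ u κ) ^ 2 + (σ : ℂ) ^ 2 * (u ^ 2 + Complex.I * u) ∈ Complex.slitPlane) :
    HasDerivAt (df σ ρ u) (ξf σ ρ u κ / df σ ρ u κ) κ := by
  have h := (hasDerivAt_csqrt hw).comp κ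
    (((hasDerivAt_ξf σ ρ u κ).pow 2).add_const ((σ : ℂ) ^ 2 * (u ^ 2 + Complex.I * u)))
  refine h.congr_deriv ?_
  have hd : df σ ρ u κ ≠ 0 := csqrt_ne_zero _
  rw [← df]
  field_simp
  norm_num

theorem hasDerivAt_A₁f {σ ρ : ℝ} (t : ℝ) {u : ℂ} {κ : ℝ}
    (hw : (ξf σ ρ u κ) ^ 2 + (σ : ℂ) ^ 2 * (u ^ 2 + Complex.I * u) ∈ Complex.slitPlane) :
    HasDerivAt (A₁f σ ρ t u) ((u ^ 2 + Complex.I * u) * t * ξf σ ρ u κ *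
      Complex.cosh (df σ ρ u κ * t / 2) / (2 * df σ ρ u κ)) κ := by
  have hdt := ((hasDerivAt_df hw).mul_const (t : ℂ)).div_const 2
  have h := ((Complex.hasDerivAt_sinh _).comp κ hdt).const_mul (u ^ 2 + Complex.I * u)
  refine h.congr_deriv ?_
  have hd : df σ ρ u κ ≠ 0 := csqrt_ne_zero _
  field_simp

theorem hasDerivAt_A₂f {σ ρ : ℝ} (t : ℝ) {u : ℂ} {κ : ℝ}
    (hw : (ξf σ ρ u κ) ^ 2 + (σ : ℂ) ^ 2 * (u ^ 2 + Complex.I * u) ∈ Complex.slitPlane) :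
    HasDerivAt (A₂f σ ρ t u) ((2 + t * ξf σ ρ u κ) *
      (ξf σ ρ u κ * Complex.cosh (df σ ρ u κ * t / 2) +
        df σ ρ u κ * Complex.sinh (df σ ρ u κ * t / 2)) / (2 * df σ ρ u κ)) κ := by
  have hdt := ((hasDerivAt_df hw).mul_const (t : ℂ)).div_const 2
  have h := ((hasDerivAt_df hw).mul ((Complex.hasDerivAt_cosh _).comp κ hdt)).add
    ((hasDerivAt_ξf σ ρ u κ).mul ((Complex.hasDerivAt_sinh _).comp κ hdt))
  refine h.congr_deriv ?_
  have hd : df σ ρ u κ ≠ 0 := csqrt_ne_zero _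
  simp only [Function.comp_apply]
  field_simp
  ring

theorem Xf_eq (σ ρ t : ℝ) (u : ℂ) (κ : ℝ) :
    Xf σ ρ t u κ = A₂f σ ρ t u κ * Complex.exp (-(df σ ρ u κ * t / 2)) := by
  have h1 : Complex.exp (-(df σ ρ u κ * t)) = Complex.exp (-(df σ ρ u κ * t / 2)) ^ 2 := by
    rw [← Complex.exp_nat_mul]
    congr 1
    push_cast
    ring
  have h2 : Complex.exp (df σ ρ u κ * t / 2) * Complex.exp (-(df σ ρ u κ * t / 2)) = 1 := by
    rw [← Complex.exp_add, add_neg_cancel, Complex.exp_zero]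
  rw [Xf, A₂f, Complex.cosh, Complex.sinh, h1]
  linear_combination (-(df σ ρ u κ + ξf σ ρ u κ) / 2) * h2

/-- The logarithmic derivative of `B = exp D`, computed from the formula for `D`. -/
theorem hasDerivAt_Dfn {σ ρ t : ℝ} {u : ℂ} {κ : ℝ} {a : ℂ}
    (hw : (ξf σ ρ u κ) ^ 2 + (σ : ℂ) ^ 2 * (u ^ 2 + Complex.I * u) ∈ Complex.slitPlane)
    (hd : df σ ρ u κ ∈ Complex.slitPlane) (hX : Xf σ ρ t u κ ∈ Complex.slitPlane)
    (hA₂ : HasDerivAt (A₂f σ ρ t u) a κ) :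
    HasDerivAt (Dfn σ ρ t u)
      (ξf σ ρ u κ / df σ ρ u κ ^ 2 + t / 2 - a / A₂f σ ρ t u κ) κ := by
  have hd' := hasDerivAt_df hw
  have hX' := (hA₂.mul ((hd'.mul_const (t : ℂ)).div_const 2).neg.cexp).congr_of_eventuallyEq
    (.of_forall (Xf_eq σ ρ t u))
  have h := ((hd'.clog_real hd).add
    (((Complex.ofRealCLM.hasDerivAt.sub hd').mul_const (t : ℂ)).div_const 2)).sub
      (hX'.clog_real hX)
  refine h.congr_deriv ?_
  have hd0 : df σ ρ u κ ≠ 0 := csqrt_ne_zero _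
  have hA₂0 : A₂f σ ρ t u κ ≠ 0 :=
    left_ne_zero_of_mul (Xf_eq σ ρ t u κ ▸ Complex.slitPlane_ne_zero hX)
  have he := Complex.exp_ne_zero (-(df σ ρ u κ * t / 2))
  rw [Xf_eq]
  simp only [Complex.ofRealCLM_apply, Complex.ofReal_one, Pi.neg_apply]
  field_simp
  ring

/-- `∂φ/∂κ = φ·h₄` with
`h₄ = (v₀/(σiu))·Aρ' + (2v̄/σ²)·D + (2κv̄/(σ²B))·Bκ' − tv̄ρiu/σ`. -/
theorem hasDerivAt_heston_charFn_kappa (vb σ ρ v₀ r t S₀ : ℝ) (hσ : σ ≠ 0) (ht : 0 < t)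
    (hS₀ : 0 < S₀) (u : ℂ) (hu : u ≠ 0) (κ₀ : ℝ)
    (hw : (ξf σ ρ u κ₀) ^ 2 + (σ : ℂ) ^ 2 * (u ^ 2 + Complex.I * u) ∈ Complex.slitPlane)
    (hd : df σ ρ u κ₀ ∈ Complex.slitPlane)
    (hX : Xf σ ρ t u κ₀ ∈ Complex.slitPlane)
    (hA₂0 : A₂f σ ρ t u κ₀ ≠ 0)
    (A₁ρ' A₂ρ' Aρ' Bκ' h₄ : ℂ)
    (hA₁ρ' : A₁ρ' = -(Complex.I * u * (u ^ 2 + Complex.I * u) * (t : ℂ) * ξf σ ρ u κ₀ *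
      (σ : ℂ)) * Complex.cosh (df σ ρ u κ₀ * (t : ℂ) / 2) / (2 * df σ ρ u κ₀))
    (hA₂ρ' : A₂ρ' = -((σ : ℂ) * Complex.I * u * (2 + (t : ℂ) * ξf σ ρ u κ₀)) *
      (ξf σ ρ u κ₀ * Complex.cosh (df σ ρ u κ₀ * (t : ℂ) / 2) +
        df σ ρ u κ₀ * Complex.sinh (df σ ρ u κ₀ * (t : ℂ) / 2)) / (2 * df σ ρ u κ₀))
    (hAρ' : Aρ' = (1 / A₂f σ ρ t u κ₀) * A₁ρ' - (Af σ ρ t u κ₀ / A₂f σ ρ t u κ₀) * A₂ρ')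
    (hBκ' : Bκ' = (Complex.I / ((σ : ℂ) * u)) * Complex.exp ((κ₀ : ℂ) * (t : ℂ) / 2) *
      ((1 / A₂f σ ρ t u κ₀) * (-(ξf σ ρ u κ₀) * (σ : ℂ) * Complex.I * u / df σ ρ u κ₀) -
        (df σ ρ u κ₀ / (A₂f σ ρ t u κ₀) ^ 2) * A₂ρ') +
      (t : ℂ) * Bf σ ρ t u κ₀ / 2)
    (hh₄ : h₄ = ((v₀ : ℂ) / ((σ : ℂ) * Complex.I * u)) * Aρ' +
      (2 * (vb : ℂ) / (σ : ℂ) ^ 2) * Dfn σ ρ t u κ₀ +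
      (2 * (κ₀ : ℂ) * (vb : ℂ) / ((σ : ℂ) ^ 2 * Bf σ ρ t u κ₀)) * Bκ' -
      (t : ℂ) * (vb : ℂ) * (ρ : ℂ) * Complex.I * u / (σ : ℂ)) :
    HasDerivAt (φf vb σ ρ v₀ r t S₀ u) (φf vb σ ρ v₀ r t S₀ u κ₀ * h₄) κ₀ := by
  have hd0 : df σ ρ u κ₀ ≠ 0 := csqrt_ne_zero _
  have hσ' : (σ : ℂ) ≠ 0 := Complex.ofReal_ne_zero.mpr hσ
  have he := Complex.exp_ne_zero ((κ₀ : ℂ) * t / 2)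
  have hA₁ := hasDerivAt_A₁f t hw
  have hA₂ := hasDerivAt_A₂f t hw
  set a₁ := (u ^ 2 + Complex.I * u) * t * ξf σ ρ u κ₀ *
    Complex.cosh (df σ ρ u κ₀ * t / 2) / (2 * df σ ρ u κ₀) with ha₁
  set a₂ := (2 + t * ξf σ ρ u κ₀) * (ξf σ ρ u κ₀ * Complex.cosh (df σ ρ u κ₀ * t / 2) +
    df σ ρ u κ₀ * Complex.sinh (df σ ρ u κ₀ * t / 2)) / (2 * df σ ρ u κ₀) with ha₂
  have e₁ : A₁ρ' = -(σ * Complex.I * u) * a₁ := by rw [hA₁ρ', ha₁]; ring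
  have e₂ : A₂ρ' = -(σ * Complex.I * u) * a₂ := by rw [hA₂ρ', ha₂]; ring
  have hκ : HasDerivAt (fun κ : ℝ => (κ : ℂ)) 1 κ₀ := Complex.ofRealCLM.hasDerivAt
  have hlin := ((((((hκ.const_mul (t : ℂ)).mul_const (vb : ℂ)).mul_const (ρ : ℂ)).mul_const
    Complex.I).mul_const u).div_const (σ : ℂ)).const_sub
      (Complex.I * u * ((Real.log S₀ : ℂ) + (r : ℂ) * (t : ℂ)))
  have h := ((hlin.sub ((hA₁.div hA₂ hA₂0).const_mul (v₀ : ℂ))).add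
    ((((hκ.const_mul 2).mul_const (vb : ℂ)).div_const ((σ : ℂ) ^ 2)).mul
      (hasDerivAt_Dfn hw hd hX hA₂))).cexp
  refine h.congr_deriv ?_
  change φf vb σ ρ v₀ r t S₀ u κ₀ * _ = _
  congr 1
  have hA : (v₀ : ℂ) / (σ * Complex.I * u) * Aρ' =
      -(v₀ * ((a₁ * A₂f σ ρ t u κ₀ - A₁f σ ρ t u κ₀ * a₂) / A₂f σ ρ t u κ₀ ^ 2)) := by
    rw [hAρ', e₁, e₂, Af]
    have hI := Complex.I_ne_zero
    field_simp
    ring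
  have hB : Bκ' = Bf σ ρ t u κ₀ *
      (ξf σ ρ u κ₀ / df σ ρ u κ₀ ^ 2 + t / 2 - a₂ / A₂f σ ρ t u κ₀) := by
    rw [hBκ', e₂, Bf]
    field_simp
    linear_combination (2 * df σ ρ u κ₀ ^ 2 * a₂ - 2 * A₂f σ ρ t u κ₀ * ξf σ ρ u κ₀) *
      Complex.I_sq
  have hB0 : Bf σ ρ t u κ₀ ≠ 0 := div_ne_zero (mul_ne_zero hd0 he) hA₂0
  rw [hh₄, hA, hB]
  field_simp
  ring
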